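/- Let p be a prime number, N ≥ 1 an integer, and G a subgroup of (ℤ/p^Nℤ)ˣ acting on M = ℤ/p^Nℤ by multiplication. If G is not cyclic, then H¹(G, M) has exactly two elements, and every class in H¹(G, M) restricts to zero in H¹(C, M) for every cyclic subgroup C of G. -/

import Mathlib

/-- `f : G → ℤ/nℤ` is a 1-cocycle for the subgroup `G ≤ (ℤ/nℤ)ˣ` acting on `M = ℤ/nℤ`
by multiplication: `f(gh) = f(g) + g·f(h)` for all `g, h ∈ G`. -/
def IsCocycle {n : ℕ} (G : Subgroup (ZMod n)ˣ) (f : G → ZMod n) : Prop :=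
  ∀ g h : G, f (g * h) = f g + ((g : (ZMod n)ˣ) : ZMod n) * f h

/-- `f : G → ℤ/nℤ` is a 1-coboundary: there is `m ∈ M` with `f(g) = g·m − m` for all `g ∈ G`. -/
def IsCoboundary {n : ℕ} (G : Subgroup (ZMod n)ˣ) (f : G → ZMod n) : Prop :=
  ∃ m : ZMod n, ∀ g : G, f g = ((g : (ZMod n)ˣ) : ZMod n) * m - m

namespace ZMod

/-- The units of `ZMod (2 ^ N)` that are congruent to `1` modulo `4`. -/
def unitsOneModFour {N : ℕ} (hN : 2 ≤ N) : Subgroup (ZMod (2 ^ N))ˣ :=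
  (unitsMap (pow_dvd_pow 2 hN : 2 ^ 2 ∣ 2 ^ N)).ker

lemma exists_eq_one_add_four_mul {N : ℕ} {hN : 2 ≤ N} {g : (ZMod (2 ^ N))ˣ}
    (hg : g ∈ unitsOneModFour hN) : ∃ y : ZMod (2 ^ N), (g : ZMod (2 ^ N)) = 1 + 4 * y := by
  have h1 : castHom (pow_dvd_pow 2 hN : 2 ^ 2 ∣ 2 ^ N) (ZMod (2 ^ 2)) (g : ZMod (2 ^ N)) = 1 :=
    congrArg Units.val (show unitsMap _ g = 1 from hg)
  have h2 : castHom (pow_dvd_pow 2 hN : 2 ^ 2 ∣ 2 ^ N) (ZMod (2 ^ 2))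
      ((g : ZMod (2 ^ N)) - 1) = 0 := by rw [map_sub, h1, map_one, sub_self]
  rw [← natCast_zmod_val ((g : ZMod (2 ^ N)) - 1), map_natCast, natCast_eq_zero_iff] at h2
  obtain ⟨k, hk⟩ := h2
  refine ⟨k, ?_⟩
  have h3 := natCast_zmod_val ((g : ZMod (2 ^ N)) - 1)
  rw [hk] at h3
  push_cast at h3
  linear_combination -h3

lemma mem_or_neg_mem_unitsOneModFour {N : ℕ} (hN : 2 ≤ N) (g : (ZMod (2 ^ N))ˣ) :
    g ∈ unitsOneModFour hN ∨ -g ∈ unitsOneModFour hN := by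
  have key : ∀ u : (ZMod (2 ^ 2))ˣ, u = 1 ∨ -u = 1 := by decide
  have hneg : unitsMap (pow_dvd_pow 2 hN : 2 ^ 2 ∣ 2 ^ N) (-g) =
      -unitsMap (pow_dvd_pow 2 hN : 2 ^ 2 ∣ 2 ^ N) g := by
    ext
    simp [unitsMap]
  rcases key (unitsMap (pow_dvd_pow 2 hN : 2 ^ 2 ∣ 2 ^ N) g) with h | h
  · exact .inl h
  · exact .inr (hneg.trans h)

lemma neg_one_notMem_unitsOneModFour {N : ℕ} (hN : 2 ≤ N) : -1 ∉ unitsOneModFour hN := by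
  intro h
  have h1 : castHom (pow_dvd_pow 2 hN : 2 ^ 2 ∣ 2 ^ N) (ZMod (2 ^ 2)) (-1) = 1 :=
    congrArg Units.val (show unitsMap _ (-1) = 1 from h)
  rw [map_neg, map_one] at h1
  exact absurd h1 (by decide)

lemma isCyclic_unitsOneModFour {N : ℕ} (hN : 2 ≤ N) : IsCyclic (unitsOneModFour hN) := by
  obtain ⟨n, rfl⟩ := Nat.exists_eq_add_of_le' hN
  have hindex : (unitsOneModFour hN).index = 2 := by
    rw [unitsOneModFour, Subgroup.index_ker, MonoidHom.range_eq_top.2 (unitsMap_surjective _),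
      Subgroup.card_top, Nat.card_eq_fintype_card]
    decide
  have hcard : Nat.card (unitsOneModFour hN) = 2 ^ n := by
    have h := (unitsOneModFour hN).card_mul_index
    rw [hindex, Nat.card_eq_fintype_card (α := (ZMod (2 ^ (n + 2)))ˣ), card_units_eq_totient,
      Nat.totient_prime_pow Nat.prime_two (by lia)] at h
    simp [pow_succ] at h
    exact h
  have h5 : IsUnit (5 : ZMod (2 ^ (n + 2))) := by
    have := (isUnit_iff_coprime 5 (2 ^ (n + 2))).2 (Nat.Coprime.pow_right _ (by norm_num))
    exact_mod_cast this
  have hmem : h5.unit ∈ unitsOneModFour hN := by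
    change unitsMap _ h5.unit = 1
    ext
    change castHom (pow_dvd_pow 2 hN : 2 ^ 2 ∣ 2 ^ (n + 2)) (ZMod (2 ^ 2)) 5 = 1
    rw [map_ofNat]
    decide
  refine isCyclic_of_orderOf_eq_card (⟨h5.unit, hmem⟩ : unitsOneModFour hN) ?_
  rw [hcard, ← orderOf_five n, Subgroup.orderOf_mk, ← orderOf_units, IsUnit.unit_spec]

lemma eq_zero_or_eq_two_pow_of_two_mul_eq_zero {n : ℕ} {x : ZMod (2 ^ (n + 1))}
    (hx : 2 * x = 0) : x = 0 ∨ x = 2 ^ n := by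
  have h1 : ((2 * x.val : ℕ) : ZMod (2 ^ (n + 1))) = 0 := by
    push_cast
    rwa [natCast_zmod_val]
  rw [natCast_eq_zero_iff] at h1
  obtain ⟨q, hq⟩ := Nat.dvd_of_mul_dvd_mul_left two_pos ((pow_succ' 2 n).symm.dvd.trans h1)
  have hlt := x.val_lt
  rw [hq, pow_succ] at hlt
  have hq2 : q < 2 := Nat.lt_of_mul_lt_mul_left hlt
  rw [← natCast_zmod_val x, hq]
  interval_cases q <;> simp

lemma two_pow_mul_two_eq_zero (n : ℕ) : (2 : ZMod (2 ^ (n + 1))) * 2 ^ n = 0 := by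
  rw [← pow_succ']
  exact_mod_cast natCast_self (2 ^ (n + 1))

lemma two_pow_ne_zero (n : ℕ) : (2 : ZMod (2 ^ (n + 1))) ^ n ≠ 0 := by
  intro h
  have h1 : ((2 ^ n : ℕ) : ZMod (2 ^ (n + 1))) = 0 := by exact_mod_cast h
  rw [natCast_eq_zero_iff] at h1
  exact absurd (Nat.pow_dvd_pow_iff_le_right (by norm_num) |>.1 h1) (by lia)

lemma exists_eq_two_mul_of_two_pow_mul_eq_zero {n : ℕ} {x : ZMod (2 ^ (n + 1))}
    (hx : 2 ^ n * x = 0) : ∃ m, x = 2 * m := by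
  have h1 : ((2 ^ n * x.val : ℕ) : ZMod (2 ^ (n + 1))) = 0 := by
    push_cast
    rwa [natCast_zmod_val]
  rw [natCast_eq_zero_iff] at h1
  obtain ⟨q, hq⟩ :=
    Nat.dvd_of_mul_dvd_mul_left (by positivity) ((pow_succ 2 n).symm.dvd.trans h1)
  refine ⟨q, ?_⟩
  rw [← natCast_zmod_val x, hq]
  push_cast
  rfl

lemma dvd_two_pow_of_ne_zero {n : ℕ} {x : ZMod (2 ^ (n + 1))} (hx : x ≠ 0) : x ∣ 2 ^ n := by
  have hv : x.val ≠ 0 := by rwa [Ne, val_eq_zero]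
  obtain ⟨k, m, hm, hk⟩ := Nat.exists_eq_two_pow_mul_odd hv
  have hu : IsUnit (m : ZMod (2 ^ (n + 1))) :=
    (isUnit_iff_coprime m _).2 (Nat.Coprime.pow_right _ hm.coprime_two_right)
  have hkn : k ≤ n := by
    have h1 : 2 ^ k ≤ x.val := hk ▸ Nat.le_mul_of_pos_right _ hm.pos
    have h2 := (Nat.pow_lt_pow_iff_right (by norm_num)).1 (h1.trans_lt x.val_lt)
    lia
  rw [← natCast_zmod_val x, hk]
  push_cast
  rw [hu.mul_right_dvd]
  exact pow_dvd_pow _ hkn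

lemma two_dvd_orderOf_of_ne_one {n : ℕ} {s : (ZMod (2 ^ (n + 1)))ˣ} (hs : s ≠ 1) :
    2 ∣ orderOf s := by
  have h := orderOf_dvd_natCard s
  rw [Nat.card_eq_fintype_card, card_units_eq_totient,
    Nat.totient_prime_pow Nat.prime_two (by lia), Nat.add_sub_cancel, Nat.add_one_sub_one,
    mul_one] at h
  obtain ⟨k, -, hk⟩ := (Nat.dvd_prime_pow Nat.prime_two).1 h
  rw [hk]
  refine dvd_pow_self 2 ?_
  rintro rfl
  rw [pow_zero, orderOf_eq_one_iff] at hk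
  exact hs hk

end ZMod

namespace IsCocycle

variable {n : ℕ} {G : Subgroup (ZMod n)ˣ} {f f' : G → ZMod n}

lemma map_one (hf : IsCocycle G f) : f 1 = 0 := by
  have h := hf 1 1
  simpa using h

/-- The subgroup on which a cocycle vanishes. -/
def zeros (hf : IsCocycle G f) : Subgroup G where
  carrier := {g | f g = 0}
  one_mem' := hf.map_one
  mul_mem' {a b} ha hb := by
    change f a = 0 at ha
    change f b = 0 at hb
    change f (a * b) = 0
    rw [hf, ha, hb, mul_zero, add_zero]
  inv_mem' {a} ha := by
    change f a = 0 at ha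
    change f a⁻¹ = 0
    have h := hf a⁻¹ a
    rwa [inv_mul_cancel, hf.map_one, ha, mul_zero, add_zero, eq_comm] at h

lemma sub (hf : IsCocycle G f) (hf' : IsCocycle G f') : IsCocycle G (f - f') := by
  intro g h
  simp only [Pi.sub_apply, hf g h, hf' g h]
  ring

lemma map_mul_comm (hf : IsCocycle G f) (g h : G) :
    f g + ((g : (ZMod n)ˣ) : ZMod n) * f h = f h + ((h : (ZMod n)ˣ) : ZMod n) * f g := by
  rw [← hf, ← hf, mul_comm]

end IsCocycle

lemma IsCoboundary.isCocycle {n : ℕ} {G : Subgroup (ZMod n)ˣ} {f : G → ZMod n}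
    (hf : IsCoboundary G f) : IsCocycle G f := by
  obtain ⟨m, hm⟩ := hf
  intro g h
  rw [hm, hm, hm]
  push_cast
  ring

/-- A noncyclic subgroup of `(ZMod (2 ^ N))ˣ` is generated by `-1` and a nontrivial element that
is congruent to `1` modulo `4`. -/
lemma exists_generator_of_not_isCyclic {N : ℕ} (hN : 2 ≤ N) (G : Subgroup (ZMod (2 ^ N))ˣ)
    (hG : ¬ IsCyclic G) :
    -1 ∈ G ∧ ∃ s ∈ G, s ≠ 1 ∧ s ∈ ZMod.unitsOneModFour hN ∧
      ∀ g ∈ G, ∃ k : ℤ, g = s ^ k ∨ g = -s ^ k := by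
  have hU := ZMod.isCyclic_unitsOneModFour hN
  have hneg : -1 ∈ G := by
    by_contra hneg
    apply hG
    obtain ⟨⟨c, hc⟩, hgen⟩ := hU.exists_generator
    have : IsCyclic ((ZMod (2 ^ N))ˣ ⧸ Subgroup.zpowers (-1 : (ZMod (2 ^ N))ˣ)) := by
      refine ⟨QuotientGroup.mk c, fun x => ?_⟩
      obtain ⟨g, rfl⟩ := QuotientGroup.mk_surjective x
      rcases ZMod.mem_or_neg_mem_unitsOneModFour hN g with h | h
      · obtain ⟨k, hk⟩ := hgen ⟨g, h⟩
        refine ⟨k, ?_⟩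
        have hk' : c ^ k = g := congrArg Subtype.val hk
        rw [← hk']
        rfl
      · obtain ⟨k, hk⟩ := hgen ⟨-g, h⟩
        refine ⟨k, ?_⟩
        have hk' : c ^ k = -g := congrArg Subtype.val hk
        change QuotientGroup.mk (c ^ k) = _
        rw [hk', QuotientGroup.eq]
        exact ⟨1, by simp⟩
    refine isCyclic_of_injective ((QuotientGroup.mk' (Subgroup.zpowers (-1))).comp G.subtype) ?_
    rw [injective_iff_map_eq_one]
    rintro ⟨g, hg⟩ h
    have h' : g ∈ Subgroup.zpowers (-1 : (ZMod (2 ^ N))ˣ) :=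
      (QuotientGroup.eq_one_iff g).1 h
    obtain ⟨k, rfl⟩ := h'
    rcases Int.even_or_odd k with hk | hk
    · exact Subtype.ext hk.neg_one_zpow
    · exact absurd (hk.neg_one_zpow (α := (ZMod (2 ^ N))ˣ) ▸ hg) hneg
  have hcyc : IsCyclic ↥(G ⊓ ZMod.unitsOneModFour hN) :=
    isCyclic_of_injective (Subgroup.inclusion inf_le_right) (Subgroup.inclusion_injective _)
  obtain ⟨⟨s, hs⟩, hgen⟩ := hcyc.exists_generator
  have hpow : ∀ g ∈ G, ∃ k : ℤ, g = s ^ k ∨ g = -s ^ k := by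
    intro g hg
    rcases ZMod.mem_or_neg_mem_unitsOneModFour hN g with h | h
    · obtain ⟨k, hk⟩ := hgen ⟨g, hg, h⟩
      exact ⟨k, .inl (congrArg Subtype.val hk).symm⟩
    · have hg' : -g ∈ G := by simpa using G.mul_mem hneg hg
      obtain ⟨k, hk⟩ := hgen ⟨-g, hg', h⟩
      have hk' : s ^ k = -g := congrArg Subtype.val hk
      exact ⟨k, .inr (by rw [hk', neg_neg])⟩
  refine ⟨hneg, s, hs.1, ?_, hs.2, hpow⟩
  rintro rfl
  refine hG ⟨⟨-1, hneg⟩, ?_⟩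
  rintro ⟨g, hg⟩
  obtain ⟨k, hk⟩ := hpow g hg
  rw [one_zpow] at hk
  rcases hk with rfl | rfl
  · exact ⟨0, zpow_zero _⟩
  · exact ⟨1, by simp⟩

/-- If `G` contains `-1` and some nontrivial `s` congruent to `1` modulo `4`, then the value of
every cocycle at `-1` is even. -/
lemma exists_map_neg_one_eq {n : ℕ} (hn : 2 ≤ n) {G : Subgroup (ZMod (2 ^ (n + 1)))ˣ}
    (hneg : -1 ∈ G) {s : (ZMod (2 ^ (n + 1)))ˣ} (hsG : s ∈ G) (hs1 : s ≠ 1)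
    (hs : s ∈ ZMod.unitsOneModFour (show 2 ≤ n + 1 by lia))
    {f : G → ZMod (2 ^ (n + 1))} (hf : IsCocycle G f) :
    ∃ m, f ⟨-1, hneg⟩ = 2 * m := by
  obtain ⟨z, hzs, hz2, hz1⟩ : ∃ z ∈ Subgroup.zpowers s, z * z = 1 ∧ z ≠ 1 := by
    have hdvd : 2 ∣ Nat.card (Subgroup.zpowers s) := by
      rw [Nat.card_zpowers]
      exact ZMod.two_dvd_orderOf_of_ne_one hs1
    obtain ⟨⟨z, hz⟩, hord⟩ := exists_prime_orderOf_dvd_card' 2 hdvd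
    rw [Subgroup.orderOf_mk] at hord
    refine ⟨z, hz, ?_, ?_⟩
    · rw [← sq]
      exact orderOf_dvd_iff_pow_eq_one.1 hord.dvd
    · rintro rfl
      simp at hord
  have hzG : z ∈ G := (Subgroup.zpowers_le.2 hsG) hzs
  obtain ⟨y, hy⟩ := ZMod.exists_eq_one_add_four_mul ((Subgroup.zpowers_le.2 hs) hzs)
  have hzz : (z : ZMod (2 ^ (n + 1))) * z = 1 := congrArg Units.val hz2
  have hunit : IsUnit (1 + 2 * y) := by
    refine IsNilpotent.isUnit_one_add ((Commute.all _ _).isNilpotent_mul_right ⟨n + 1, ?_⟩)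
    exact_mod_cast ZMod.natCast_self (2 ^ (n + 1))
  have hz : (z : ZMod (2 ^ (n + 1))) - 1 = 2 ^ n := by
    have h2 : 2 * ((z : ZMod (2 ^ (n + 1))) - 1) = 0 := by
      refine hunit.mul_left_cancel ?_
      linear_combination hzz + (-(z : ZMod (2 ^ (n + 1))) + 1) * hy
    rcases ZMod.eq_zero_or_eq_two_pow_of_two_mul_eq_zero h2 with h | h
    · exact absurd (Units.ext (sub_eq_zero.1 h)) hz1
    · exact h
  have hfz : 2 * f ⟨z, hzG⟩ = 0 := by
    have h := hf ⟨z, hzG⟩ ⟨z, hzG⟩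
    have h1 : (⟨z, hzG⟩ * ⟨z, hzG⟩ : G) = 1 := Subtype.ext hz2
    rw [h1, hf.map_one] at h
    refine hunit.mul_left_cancel ?_
    linear_combination -h - f ⟨z, hzG⟩ * hy
  have hcomm := hf.map_mul_comm ⟨-1, hneg⟩ ⟨z, hzG⟩
  simp only [Units.val_neg, Units.val_one] at hcomm
  apply ZMod.exists_eq_two_mul_of_two_pow_mul_eq_zero
  linear_combination -hcomm - hfz - f ⟨-1, hneg⟩ * hz

/-- A cocycle vanishing at `-1` takes values in the `2`-torsion. -/
lemma IsCocycle.two_mul_eq_zero {n : ℕ} {G : Subgroup (ZMod n)ˣ} {f : G → ZMod n}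
    (hf : IsCocycle G f) (hneg : -1 ∈ G) (h : f ⟨-1, hneg⟩ = 0) (g : G) : 2 * f g = 0 := by
  have hcomm := hf.map_mul_comm ⟨-1, hneg⟩ g
  rw [h] at hcomm
  simp only [Units.val_neg, Units.val_one] at hcomm
  linear_combination -hcomm

/-- If `G` is generated by `-1` and some nontrivial `s` congruent to `1` modulo `4`, then there is
a cocycle that vanishes at `-1` but not at `s`. -/
lemma exists_isCocycle_map_neg_one_eq_zero {n : ℕ} (hn : 2 ≤ n + 1)
    {G : Subgroup (ZMod (2 ^ (n + 1)))ˣ}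
    (hneg : -1 ∈ G) {s : (ZMod (2 ^ (n + 1)))ˣ} (hsG : s ∈ G) (hs1 : s ≠ 1)
    (hs : s ∈ ZMod.unitsOneModFour hn) (hgen : ∀ g ∈ G, ∃ k : ℤ, g = s ^ k ∨ g = -s ^ k) :
    ∃ f : G → ZMod (2 ^ (n + 1)), IsCocycle G f ∧ f ⟨-1, hneg⟩ = 0 ∧ f ⟨s, hsG⟩ = 2 ^ n := by
  classical
  have hodd : ∀ k : ℤ, s ^ k = 1 → Even k := by
    intro k hk
    rw [← orderOf_dvd_iff_zpow_eq_one] at hk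
    rw [even_iff_two_dvd]
    exact (Int.natCast_dvd_natCast.2 (ZMod.two_dvd_orderOf_of_ne_one hs1)).trans hk
  have hne : ∀ i j : ℤ, s ^ i ≠ -s ^ j := by
    intro i j h
    apply ZMod.neg_one_notMem_unitsOneModFour hn
    have h1 : (-1 : (ZMod (2 ^ (n + 1)))ˣ) = s ^ (i - j) := by
      rw [zpow_sub, h, neg_mul, mul_inv_cancel]
    rw [h1]
    exact Subgroup.zpow_mem _ hs _
  have hpar : ∀ i j : ℤ, s ^ i = s ^ j → (Even i ↔ Even j) := by
    intro i j h
    rw [← Int.even_sub]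
    exact hodd _ (by rw [zpow_sub, h, mul_inv_cancel])
  let P : (ZMod (2 ^ (n + 1)))ˣ → Prop := fun g => ∃ k : ℤ, Even k ∧ (g = s ^ k ∨ g = -s ^ k)
  have hP : ∀ k : ℤ, P (s ^ k) ↔ Even k := by
    refine fun k => ⟨?_, fun h => ⟨k, h, .inl rfl⟩⟩
    rintro ⟨j, hj, h | h⟩
    · exact (hpar _ _ h).2 hj
    · exact absurd h (hne _ _)
  have hP' : ∀ k : ℤ, P (-s ^ k) ↔ Even k := by
    refine fun k => ⟨?_, fun h => ⟨k, h, .inr rfl⟩⟩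
    rintro ⟨j, hj, h | h⟩
    · exact absurd h.symm (hne _ _)
    · exact (hpar _ _ (neg_injective h)).2 hj
  have hPmul : ∀ g ∈ G, ∀ h ∈ G, (P (g * h) ↔ (P g ↔ P h)) := by
    intro g hg h hh
    obtain ⟨i, hi⟩ := hgen g hg
    obtain ⟨j, hj⟩ := hgen h hh
    rcases hi with rfl | rfl <;> rcases hj with rfl | rfl <;>
      simp only [mul_neg, neg_mul, neg_neg, ← zpow_add, hP, hP', Int.even_add]
  have h2 := ZMod.two_pow_mul_two_eq_zero n
  have hact : ∀ g ∈ G, ((g : ZMod (2 ^ (n + 1)))) * 2 ^ n = 2 ^ n := by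
    intro g hg
    rcases ZMod.mem_or_neg_mem_unitsOneModFour hn g with h | h
    · obtain ⟨y, hy⟩ := ZMod.exists_eq_one_add_four_mul h
      linear_combination 2 ^ n * hy + 2 * y * h2
    · obtain ⟨y, hy⟩ := ZMod.exists_eq_one_add_four_mul h
      rw [Units.val_neg] at hy
      linear_combination -2 ^ n * hy - (1 + 2 * y) * h2
  refine ⟨fun g => if P g then 0 else 2 ^ n, ?_, ?_, ?_⟩
  · rintro ⟨g, hg⟩ ⟨h, hh⟩
    simp only [MulMemClass.mk_mul_mk, hPmul g hg h hh]
    by_cases h1 : P g <;> by_cases h3 : P h <;> simp [h1, h3, hact g hg, ← two_mul, h2]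
  · have := (hP' 0).2 Even.zero
    rw [zpow_zero] at this
    simp [this]
  · have := hP 1
    rw [zpow_one] at this
    simp [this]

/-- Let `p` be a prime, `N ≥ 1`, and `G ≤ (ℤ/p^Nℤ)ˣ` acting on `M = ℤ/p^Nℤ` by multiplication.
If `G` is not cyclic, then `H¹(G, M)` has exactly two elements (there is a 1-cocycle `f₀` that is
not a coboundary, and every 1-cocycle is, modulo coboundaries, `0` or `f₀`), and every class in
`H¹(G, M)` restricts to zero in `H¹(C, M)` for every cyclic subgroup `C ≤ G`: for every 1-cocycle
`f : G → M` and every cyclic `C ≤ G` there is `m ∈ M` with `f(g) = g·m − m` for all `g ∈ C`. -/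
theorem stmt_4 (p : ℕ) (hp : p.Prime) (N : ℕ) (hN : 1 ≤ N)
    (G : Subgroup (ZMod (p ^ N))ˣ) (hG : ¬ IsCyclic G) :
    (∃ f₀ : G → ZMod (p ^ N), IsCocycle G f₀ ∧ ¬ IsCoboundary G f₀ ∧
      ∀ f : G → ZMod (p ^ N), IsCocycle G f →
        (IsCoboundary G f ∨ IsCoboundary G (f - f₀))) ∧
    (∀ C : Subgroup (ZMod (p ^ N))ˣ, C ≤ G → IsCyclic C →
      ∀ f : G → ZMod (p ^ N), IsCocycle G f →
        ∃ m : ZMod (p ^ N), ∀ g : G, (g : (ZMod (p ^ N))ˣ) ∈ C →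
          f g = ((g : (ZMod (p ^ N))ˣ) : ZMod (p ^ N)) * m - m) := by
  have hp2 : p = 2 := by
    by_contra hp2
    have := ZMod.isCyclic_units_of_prime_pow p hp hp2 N
    exact hG inferInstance
  subst hp2
  have hN3 : 3 ≤ N := by
    by_contra h
    have := (ZMod.isCyclic_units_two_pow_iff N).2 (by lia)
    exact hG inferInstance
  obtain ⟨n, rfl⟩ := Nat.exists_eq_add_of_le' hN
  obtain ⟨hneg, s, hsG, hs1, hs, hgen⟩ :=
    exists_generator_of_not_isCyclic (show 2 ≤ n + 1 by lia) G hG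
  have hreduce : ∀ f : G → ZMod (2 ^ (n + 1)), IsCocycle G f →
      ∃ m f', IsCocycle G f' ∧ f' ⟨-1, hneg⟩ = 0 ∧
        ∀ g : G, f g = f' g + (((g : (ZMod (2 ^ (n + 1)))ˣ) : ZMod (2 ^ (n + 1))) * m - m) := by
    intro f hf
    obtain ⟨m, hm⟩ := exists_map_neg_one_eq (by lia) hneg hsG hs1 hs hf
    refine ⟨-m, f - fun g : G => ((g : (ZMod (2 ^ (n + 1)))ˣ) : ZMod (2 ^ (n + 1))) * (-m) - (-m),
      hf.sub (IsCoboundary.isCocycle ⟨-m, fun _ => rfl⟩), ?_, fun g => ?_⟩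
    · simp only [Pi.sub_apply, hm, Units.val_neg, Units.val_one]
      ring
    · simp only [Pi.sub_apply]
      ring
  have hzero : ∀ f : G → ZMod (2 ^ (n + 1)), IsCocycle G f → f ⟨-1, hneg⟩ = 0 →
      f ⟨s, hsG⟩ = 0 → ∀ g, f g = 0 := by
    rintro f hf h1 h2 ⟨g, hg⟩
    have hpow (k : ℤ) : (⟨s, hsG⟩ : G) ^ k ∈ hf.zeros := hf.zeros.zpow_mem h2 k
    obtain ⟨k, rfl | rfl⟩ := hgen g hg
    · exact hpow k
    · have := hf.zeros.mul_mem (show (⟨-1, hneg⟩ : G) ∈ hf.zeros from h1) (hpow k)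
      have heq : (⟨-1, hneg⟩ : G) * ⟨s, hsG⟩ ^ k = ⟨-s ^ k, hg⟩ := Subtype.ext (by simp)
      exact heq ▸ this
  refine ⟨?_, ?_⟩
  · obtain ⟨f₀, hf₀, hf₀neg, hf₀s⟩ :=
      exists_isCocycle_map_neg_one_eq_zero (by lia) hneg hsG hs1 hs hgen
    refine ⟨f₀, hf₀, ?_, fun f hf => ?_⟩
    · rintro ⟨m, hm⟩
      obtain ⟨y, hy⟩ := ZMod.exists_eq_one_add_four_mul hs
      have h1 := hm ⟨-1, hneg⟩
      have h2 := hm ⟨s, hsG⟩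
      rw [hf₀neg] at h1
      rw [hf₀s] at h2
      simp only [Units.val_neg, Units.val_one] at h1
      exact ZMod.two_pow_ne_zero n (by linear_combination h2 + m * hy + 2 * y * h1)
    · obtain ⟨m, f', hf', hf'neg, hff'⟩ := hreduce f hf
      rcases ZMod.eq_zero_or_eq_two_pow_of_two_mul_eq_zero
        (hf'.two_mul_eq_zero hneg hf'neg ⟨s, hsG⟩) with h | h
      · exact .inl ⟨m, fun g => by rw [hff', hzero f' hf' hf'neg h, zero_add]⟩
      · refine .inr ⟨m, fun g => ?_⟩
        have := hzero (f' - f₀) (hf'.sub hf₀) (by simp [hf'neg, hf₀neg]) (by simp [h, hf₀s]) g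
        simp only [Pi.sub_apply] at this ⊢
        rw [hff']
        linear_combination this
  · intro C hCG hC f hf
    obtain ⟨m, f', hf', hf'neg, hff'⟩ := hreduce f hf
    obtain ⟨⟨c, hc⟩, hgenC⟩ := hC.exists_generator
    obtain ⟨m', hm'⟩ : ∃ m', f' ⟨c, hCG hc⟩ = (c : ZMod (2 ^ (n + 1))) * m' - m' := by
      rcases ZMod.eq_zero_or_eq_two_pow_of_two_mul_eq_zero
        (hf'.two_mul_eq_zero hneg hf'neg ⟨c, hCG hc⟩) with h | h
      · exact ⟨0, by simp [h]⟩
      · by_cases hc1 : c = 1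
        · subst hc1
          exact ⟨0, by simpa using! hf'.map_one⟩
        · obtain ⟨m', hm'⟩ := ZMod.dvd_two_pow_of_ne_zero
            (sub_ne_zero.2 fun h => hc1 (Units.ext h) : (c : ZMod (2 ^ (n + 1))) - 1 ≠ 0)
          exact ⟨m', by rw [h, hm']; ring⟩
    have hd := hf'.sub (IsCoboundary.isCocycle (G := G) ⟨m', fun _ => rfl⟩)
    refine ⟨m + m', fun g hg => ?_⟩
    obtain ⟨k, hk⟩ := hgenC ⟨g, hg⟩
    have hck : c ^ k = g := congrArg Subtype.val hk
    have hgk : (⟨c, hCG hc⟩ : G) ^ k = g := Subtype.ext hck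
    have hmem : (⟨c, hCG hc⟩ : G) ∈ hd.zeros := sub_eq_zero.2 hm'
    have h0 := hd.zeros.zpow_mem hmem k
    rw [hgk] at h0
    have h1 := sub_eq_zero.1 h0
    rw [hff', h1]
    ring
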